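/- Let S be an AG-groupoid with left identity e and let P be a left ideal of S. Then P is quasi-prime if and only if for all a, b ∈ S, (Sa)b ⊆ P implies a ∈ P or b ∈ P, where Sa = {s·a : s ∈ S} and (Sa)b = {x·b : x ∈ Sa}. -/

import Mathlib

open Pointwise

section AGGroupoid

variable {S : Type*} [Mul S]

theorem medial_of_left_invertive (hinv : ∀ a b c : S, (a * b) * c = (c * b) * a)
    (a b c d : S) : (a * b) * (c * d) = (a * c) * (b * d) := by
  rw [hinv a b, hinv c d b, hinv (b * d) c a]

theorem mul_left_comm_of_left_invertive (hinv : ∀ a b c : S, (a * b) * c = (c * b) * a)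
    {e : S} (he : ∀ a : S, e * a = a) (a b c : S) : a * (b * c) = b * (a * c) := by
  simpa only [he] using medial_of_left_invertive hinv e a b c

theorem paramedial_of_left_invertive (hinv : ∀ a b c : S, (a * b) * c = (c * b) * a)
    {e : S} (he : ∀ a : S, e * a = a) (a b c d : S) :
    (a * b) * (c * d) = (d * b) * (c * a) := by
  rw [mul_left_comm_of_left_invertive hinv he (a * b), hinv a b d,
    mul_left_comm_of_left_invertive hinv he c]

theorem mul_mul_eq_of_left_invertive (hinv : ∀ a b c : S, (a * b) * c = (c * b) * a)
    {e : S} (he : ∀ a : S, e * a = a) (s t a : S) : s * (t * a) = ((t * e) * s) * a := by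
  have h := paramedial_of_left_invertive hinv he e s t a
  rwa [he, hinv a s (t * e)] at h

/-- In an AG-groupoid with left identity, `S·a` is a left ideal. -/
theorem univ_mul_univ_mul_singleton_subset (hinv : ∀ a b c : S, (a * b) * c = (c * b) * a)
    {e : S} (he : ∀ a : S, e * a = a) (a : S) :
    (Set.univ : Set S) * (Set.univ * {a}) ⊆ Set.univ * {a} := by
  rintro _ ⟨s, -, _, ⟨t, -, _, rfl, rfl⟩, rfl⟩
  exact ⟨(t * e) * s, Set.mem_univ _, _, rfl,
    (mul_mul_eq_of_left_invertive hinv he s t _).symm⟩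

end AGGroupoid

/-- Let `S` be an AG-groupoid with left identity `e` and `P` a left ideal of `S`.
Then `P` is quasi-prime (for all left ideals `A`, `B`, `A·B ⊆ P` implies `A ⊆ P`
or `B ⊆ P`) if and only if for all `a, b ∈ S`, `(S·a)·b ⊆ P` implies `a ∈ P` or
`b ∈ P`. -/
theorem quasi_prime_iff {S : Type*} [Mul S]
    (hinv : ∀ a b c : S, (a * b) * c = (c * b) * a)
    (e : S) (he : ∀ a : S, e * a = a)
    (P : Set S) (hP : (Set.univ : Set S) * P ⊆ P) :
    (∀ A B : Set S, (Set.univ : Set S) * A ⊆ A → (Set.univ : Set S) * B ⊆ B →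
        A * B ⊆ P → A ⊆ P ∨ B ⊆ P) ↔
      (∀ a b : S, ((Set.univ : Set S) * {a}) * {b} ⊆ P → a ∈ P ∨ b ∈ P) := by
  constructor
  · intro h a b hab
    have mem_univ_mul (x : S) : x ∈ (Set.univ : Set S) * {x} :=
      ⟨e, Set.mem_univ _, x, rfl, he x⟩
    refine (h (Set.univ * {a}) (Set.univ * {b})
      (univ_mul_univ_mul_singleton_subset hinv he a)
      (univ_mul_univ_mul_singleton_subset hinv he b) ?_).imp
      (fun ha => ha (mem_univ_mul a)) (fun hb => hb (mem_univ_mul b))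
    rintro _ ⟨x, hx, _, ⟨t, -, _, rfl, rfl⟩, rfl⟩
    change x * (t * _) ∈ P
    rw [mul_left_comm_of_left_invertive hinv he]
    exact hP (Set.mul_mem_mul (Set.mem_univ t) (hab (Set.mul_mem_mul hx rfl)))
  · intro h A B hA hB hAB
    by_contra! hne
    obtain ⟨a, haA, haP⟩ := Set.not_subset.1 hne.1
    obtain ⟨b, hbB, hbP⟩ := Set.not_subset.1 hne.2
    have hab : (Set.univ * {a}) * {b} ⊆ P :=
      (Set.mul_subset_mul ((Set.mul_subset_mul_left (Set.singleton_subset_iff.2 haA)).trans hA)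
        (Set.singleton_subset_iff.2 hbB)).trans hAB
    exact (h a b hab).elim haP hbP
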